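/- Suppose (X,𝒜,μ) is a Peano-Jordan complete bounded charge space with null sets 𝒩, 𝒜′ is a sub-field of 𝒜, and p ∈ {0} ∪ [1,∞). Then L_p(X,𝒜′,μ) is a dense subspace of L_p(X, α(𝒜′ ∪ 𝒩), μ) (dense in pseudometric d for p = 0 and in pseudonorm ‖·‖_p for p ≥ 1). Moreover, L_p(X,𝒜′,μ) = L_p(X, α(𝒜′ ∪ 𝒩), μ) if and only if 𝒩 ⊆ \overline{𝒜′}. -/

import Mathlib

open Filter Set Topology

section ChargeDefs

variable {X : Type*}

/-- A field of sets on `X`: contains `∅`, closed under complements and finite unions. -/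
structure IsSetField (𝒜 : Set (Set X)) : Prop where
  empty_mem : (∅ : Set X) ∈ 𝒜
  compl_mem : ∀ A ∈ 𝒜, Aᶜ ∈ 𝒜
  union_mem : ∀ A ∈ 𝒜, ∀ B ∈ 𝒜, A ∪ B ∈ 𝒜

/-- A (bounded, non-negative) charge space: a field of sets together with a finitely
additive non-negative real-valued set function vanishing on `∅`.  (The function `μ` is
given on all of `𝒫(X)`; only its values on `𝒜` are constrained or used.) -/
structure IsCharge (𝒜 : Set (Set X)) (μ : Set X → ℝ) : Prop where
  isSetField : IsSetField 𝒜
  empty : μ ∅ = 0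
  nonneg : ∀ A ∈ 𝒜, 0 ≤ μ A
  additive : ∀ A ∈ 𝒜, ∀ B ∈ 𝒜, Disjoint A B → μ (A ∪ B) = μ A + μ B

/-- The outer charge `μ*(A) = inf {μ B : B ∈ 𝒜, A ⊆ B}`. -/
noncomputable def outerCharge (𝒜 : Set (Set X)) (μ : Set X → ℝ) (A : Set X) : ℝ :=
  sInf (μ '' {B | B ∈ 𝒜 ∧ A ⊆ B})

/-- A null function: `μ*({x : |h x| > ε}) = 0` for every `ε > 0`. -/
def IsNullFn (𝒜 : Set (Set X)) (μ : Set X → ℝ) (h : X → ℝ) : Prop :=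
  ∀ ε > (0 : ℝ), outerCharge 𝒜 μ {x | ε < |h x|} = 0

/-- `f = g` almost everywhere: `f - g` is a null function. -/
def EqAE (𝒜 : Set (Set X)) (μ : Set X → ℝ) (f g : X → ℝ) : Prop :=
  IsNullFn 𝒜 μ (fun x => f x - g x)

/-- `f ≤ g` almost everywhere: `f ≤ g + h` for some null function `h`. -/
def LeAE (𝒜 : Set (Set X)) (μ : Set X → ℝ) (f g : X → ℝ) : Prop :=
  ∃ h : X → ℝ, IsNullFn 𝒜 μ h ∧ ∀ x, f x ≤ g x + h x

/-- Hazy convergence of a sequence of functions. -/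
def HazyConv (𝒜 : Set (Set X)) (μ : Set X → ℝ) (fn : ℕ → X → ℝ) (f : X → ℝ) : Prop :=
  ∀ ε > (0 : ℝ), Tendsto (fun n => outerCharge 𝒜 μ {x | ε < |fn n x - f x|}) atTop (𝓝 0)

/-- A simple function w.r.t. the field `𝒜`: `Σ c_k 1_{A_k}` for a finite partition
`{A_k} ⊆ 𝒜` of `X`. -/
def IsSimpleFn (𝒜 : Set (Set X)) (f : X → ℝ) : Prop :=
  ∃ (n : ℕ) (c : Fin n → ℝ) (A : Fin n → Set X),
    (∀ k, A k ∈ 𝒜) ∧ (Pairwise fun i j => Disjoint (A i) (A j)) ∧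
    (⋃ k, A k) = Set.univ ∧ ∀ x, f x = ∑ k, (A k).indicator (fun _ => c k) x

/-- `T₁`-measurability: `f` is the hazy limit of a sequence of simple functions.
`MemL0 𝒜 μ f` says `f ∈ L₀(X,𝒜,μ)`. -/
def MemL0 (𝒜 : Set (Set X)) (μ : Set X → ℝ) (f : X → ℝ) : Prop :=
  ∃ fn : ℕ → X → ℝ, (∀ n, IsSimpleFn 𝒜 (fn n)) ∧ HazyConv 𝒜 μ fn f

/-- Integral of a simple function: `Σ_y y·μ(f⁻¹{y})` (a finite sum for simple `f`;
for a simple function `Σ c_k 1_{A_k}` over a partition this equals `Σ c_k μ(A_k)`). -/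
noncomputable def sIntegral (μ : Set X → ℝ) (f : X → ℝ) : ℝ :=
  ∑ᶠ y, y * μ (f ⁻¹' {y})

/-- A determining sequence for `f`: simple functions converging hazily to `f` with
`∫ |f_n - f_m| dμ → 0` as `m, n → ∞`. -/
def IsDetermining (𝒜 : Set (Set X)) (μ : Set X → ℝ) (fn : ℕ → X → ℝ) (f : X → ℝ) : Prop :=
  (∀ n, IsSimpleFn 𝒜 (fn n)) ∧ HazyConv 𝒜 μ fn f ∧
    Tendsto (fun mn : ℕ × ℕ => sIntegral μ (fun x => |fn mn.1 x - fn mn.2 x|)) atTop (𝓝 0)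

/-- Integrability w.r.t. a charge: existence of a determining sequence.
`MemL1 𝒜 μ f` says `f ∈ L₁(X,𝒜,μ)`. -/
def MemL1 (𝒜 : Set (Set X)) (μ : Set X → ℝ) (f : X → ℝ) : Prop :=
  ∃ fn : ℕ → X → ℝ, IsDetermining 𝒜 μ fn f

-- The integral `∫ f dμ` of an integrable function: the limit of the integrals of
-- any determining sequence (this limit is independent of the choice).
open Classical in
noncomputable def chargeIntegral (𝒜 : Set (Set X)) (μ : Set X → ℝ) (f : X → ℝ) : ℝ :=
  if h : ∃ fn : ℕ → X → ℝ, IsDetermining 𝒜 μ fn f then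
    limUnder atTop (fun n => sIntegral μ (h.choose n))
  else 0

/-- Smoothness: for every `ε > 0` there is `k > 0` with `μ*({x : |f x| > k}) < ε`. -/
def SmoothFn (𝒜 : Set (Set X)) (μ : Set X → ℝ) (f : X → ℝ) : Prop :=
  ∀ ε > (0 : ℝ), ∃ k > (0 : ℝ), outerCharge 𝒜 μ {x | k < |f x|} < ε

/-- The field of the Peano-Jordan completion of `(X,𝒜,μ)`. -/
def pjField (𝒜 : Set (Set X)) (μ : Set X → ℝ) : Set (Set X) :=
  {A | ∀ ε > (0 : ℝ), ∃ B ∈ 𝒜, ∃ C ∈ 𝒜, B ⊆ A ∧ A ⊆ C ∧ μ (C \ B) < ε}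

/-- The charge of the Peano-Jordan completion: `μ̄(A) = sup {μ B : B ∈ 𝒜, B ⊆ A}`. -/
noncomputable def pjCharge (𝒜 : Set (Set X)) (μ : Set X → ℝ) (A : Set X) : ℝ :=
  sSup (μ '' {B | B ∈ 𝒜 ∧ B ⊆ A})

/-- The pseudometric `d` on `L₀`. -/
noncomputable def hazyDist (𝒜 : Set (Set X)) (μ : Set X → ℝ) (f g : X → ℝ) : ℝ :=
  sInf {ε : ℝ | 0 < ε ∧ outerCharge 𝒜 μ {x | ε < |f x - g x|} < ε}

/-- `f ∈ L_p(X,𝒜,μ)` for `p ∈ [1,∞)`: `f` is `T₁`-measurable and `|f|^p` integrable. -/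
def MemLpC (𝒜 : Set (Set X)) (μ : Set X → ℝ) (p : ℝ) (f : X → ℝ) : Prop :=
  MemL0 𝒜 μ f ∧ MemL1 𝒜 μ (fun x => |f x| ^ p)

/-- `f ∈ L_p` for `p ∈ {0} ∪ [1,∞)`. -/
def MemLp' (𝒜 : Set (Set X)) (μ : Set X → ℝ) (p : ℝ) (f : X → ℝ) : Prop :=
  if p = 0 then MemL0 𝒜 μ f else MemLpC 𝒜 μ p f

/-- The distance on `L_p`: the pseudometric `d` for `p = 0`, and
`‖f - g‖_p = (∫ |f-g|^p dμ)^(1/p)` for `p ≥ 1`. -/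
noncomputable def LpDist (𝒜 : Set (Set X)) (μ : Set X → ℝ) (p : ℝ) (f g : X → ℝ) : ℝ :=
  if p = 0 then hazyDist 𝒜 μ f g
  else (chargeIntegral 𝒜 μ fun x => |f x - g x| ^ p) ^ (1 / p)

/-- The collection of null sets of a charge space. -/
def nullSets (𝒜 : Set (Set X)) (μ : Set X → ℝ) : Set (Set X) :=
  {A | outerCharge 𝒜 μ A = 0}

/-- The smallest field of sets on `X` containing a given collection `𝒞`. -/
def genSetField (𝒞 : Set (Set X)) : Set (Set X) :=
  ⋂₀ {𝒟 | IsSetField 𝒟 ∧ 𝒞 ⊆ 𝒟}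

end ChargeDefs

namespace ChargeAux

variable {X : Type*} {𝒞 : Set (Set X)} {μ : Set X → ℝ}

theorem univ_mem (h : IsSetField 𝒞) : (Set.univ : Set X) ∈ 𝒞 := by
  simpa using h.compl_mem _ h.empty_mem

theorem inter_mem (h : IsSetField 𝒞) {A B : Set X} (hA : A ∈ 𝒞) (hB : B ∈ 𝒞) : A ∩ B ∈ 𝒞 := by
  have := h.compl_mem _ (h.union_mem _ (h.compl_mem _ hA) _ (h.compl_mem _ hB))
  simpa [Set.compl_union] using this

theorem diff_mem (h : IsSetField 𝒞) {A B : Set X} (hA : A ∈ 𝒞) (hB : B ∈ 𝒞) : A \ B ∈ 𝒞 := by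
  rw [Set.diff_eq]; exact inter_mem h hA (h.compl_mem _ hB)

theorem biUnion_mem (h : IsSetField 𝒞) {ι : Type*} (s : Finset ι) (f : ι → Set X)
    (hf : ∀ i ∈ s, f i ∈ 𝒞) : (⋃ i ∈ s, f i) ∈ 𝒞 := by
  classical
  induction s using Finset.induction_on with
  | empty => simpa using h.empty_mem
  | insert a s ha ih =>
    rw [Finset.set_biUnion_insert]
    exact h.union_mem _ (hf _ (by simp)) _ (ih fun i hi => hf i (by simp [hi]))

theorem mu_mono (h : IsCharge 𝒞 μ) {A B : Set X} (hA : A ∈ 𝒞) (hB : B ∈ 𝒞) (hAB : A ⊆ B) :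
    μ A ≤ μ B := by
  have hd := diff_mem h.isSetField hB hA
  have := h.additive A hA (B \ A) hd Set.disjoint_sdiff_right
  rw [Set.union_diff_cancel hAB] at this
  linarith [h.nonneg _ hd]

theorem mu_union_le (h : IsCharge 𝒞 μ) {A B : Set X} (hA : A ∈ 𝒞) (hB : B ∈ 𝒞) :
    μ (A ∪ B) ≤ μ A + μ B := by
  have hd := diff_mem h.isSetField hB hA
  have := h.additive A hA (B \ A) hd Set.disjoint_sdiff_right
  rw [Set.union_diff_self] at this
  linarith [mu_mono h hd hB Set.diff_subset]

theorem mu_biUnion (h : IsCharge 𝒞 μ) {ι : Type*} (s : Finset ι) (f : ι → Set X)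
    (hf : ∀ i ∈ s, f i ∈ 𝒞) (hd : ∀ i j, i ≠ j → Disjoint (f i) (f j)) :
    μ (⋃ i ∈ s, f i) = ∑ i ∈ s, μ (f i) := by
  classical
  induction s using Finset.induction_on with
  | empty => simpa using h.empty
  | insert a s ha ih =>
    have hf' : ∀ i ∈ s, f i ∈ 𝒞 := fun i hi => hf i (by simp [hi])
    rw [Finset.set_biUnion_insert, Finset.sum_insert ha, ← ih hf']
    apply h.additive _ (hf _ (by simp)) _ (biUnion_mem h.isSetField s f hf')
    rw [Set.disjoint_iUnion₂_right]
    intro i hi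
    exact hd _ _ (by rintro rfl; exact ha hi)

theorem sub_charge {𝒜 : Set (Set X)} (h : IsCharge 𝒜 μ) (hC : IsSetField 𝒞) (hs : 𝒞 ⊆ 𝒜) :
    IsCharge 𝒞 μ :=
  ⟨hC, h.empty, fun A hA => h.nonneg A (hs hA),
    fun A hA B hB => h.additive A (hs hA) B (hs hB)⟩

theorem outer_bdd (h : IsCharge 𝒞 μ) (A : Set X) :
    BddBelow (μ '' {B | B ∈ 𝒞 ∧ A ⊆ B}) :=
  ⟨0, by rintro _ ⟨B, hB, rfl⟩; exact h.nonneg _ hB.1⟩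

theorem outer_lt_iff (h : IsCharge 𝒞 μ) {A : Set X} {δ : ℝ} :
    outerCharge 𝒞 μ A < δ ↔ ∃ E ∈ 𝒞, A ⊆ E ∧ μ E < δ := by
  unfold outerCharge
  rw [csInf_lt_iff (outer_bdd h A) ⟨_, Set.univ, ⟨univ_mem h.isSetField, Set.subset_univ _⟩, rfl⟩]
  constructor
  · rintro ⟨_, ⟨B, hB, rfl⟩, hlt⟩
    exact ⟨B, hB.1, hB.2, hlt⟩
  · rintro ⟨E, h1, h2, h3⟩
    exact ⟨_, ⟨E, ⟨h1, h2⟩, rfl⟩, h3⟩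

theorem outer_nonneg (h : IsCharge 𝒞 μ) (A : Set X) : 0 ≤ outerCharge 𝒞 μ A := by
  apply Real.sInf_nonneg
  rintro _ ⟨B, hB, rfl⟩
  exact h.nonneg _ hB.1

theorem hazy_iff (h : IsCharge 𝒞 μ) {fn : ℕ → X → ℝ} {f : X → ℝ} :
    HazyConv 𝒞 μ fn f ↔ ∀ ε > (0:ℝ), ∀ δ > (0:ℝ), ∀ᶠ n in atTop,
      ∃ E ∈ 𝒞, μ E < δ ∧ ∀ x, x ∉ E → |fn n x - f x| ≤ ε := by
  have key : ∀ ε δ n, outerCharge 𝒞 μ {x | ε < |fn n x - f x|} < δ ↔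
      ∃ E ∈ 𝒞, μ E < δ ∧ ∀ x, x ∉ E → |fn n x - f x| ≤ ε := by
    intro ε δ n
    rw [outer_lt_iff h]
    constructor
    · rintro ⟨E, h1, h2, h3⟩
      refine ⟨E, h1, h3, fun x hx => ?_⟩
      by_contra hc
      exact hx (h2 (not_le.mp hc))
    · rintro ⟨E, h1, h3, h2⟩
      refine ⟨E, h1, fun x hx => ?_, h3⟩
      by_contra hc
      exact absurd (h2 x hc) (not_le.mpr hx)
  unfold HazyConv
  refine forall₂_congr fun ε hε => ?_
  rw [Metric.tendsto_nhds]
  refine forall₂_congr fun δ hδ => ?_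
  refine Filter.eventually_congr (Filter.Eventually.of_forall fun n => ?_)
  rw [Real.dist_eq, sub_zero, abs_of_nonneg (outer_nonneg h _)]
  exact key ε δ n

/-- Finite range with all preimages in the field. -/
def SF {β : Type*} (𝒞 : Set (Set X)) (f : X → β) : Prop :=
  (Set.range f).Finite ∧ ∀ S : Set β, f ⁻¹' S ∈ 𝒞

theorem SF.comp {β γ : Type*} {f : X → β} (hf : SF 𝒞 f) (ψ : β → γ) : SF 𝒞 (fun x => ψ (f x)) := by
  refine ⟨?_, fun S => hf.2 (ψ ⁻¹' S)⟩
  have : Set.range (fun x => ψ (f x)) = ψ '' Set.range f := by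
    rw [← Set.range_comp]; rfl
  rw [this]; exact hf.1.image _

theorem SF.of_single {β : Type*} {f : X → β} (hC : IsSetField 𝒞) (h1 : (Set.range f).Finite)
    (h2 : ∀ y, f ⁻¹' {y} ∈ 𝒞) : SF 𝒞 f := by
  classical
  refine ⟨h1, fun S => ?_⟩
  have : f ⁻¹' S = ⋃ y ∈ h1.toFinset.filter (· ∈ S), f ⁻¹' {y} := by
    ext x; simp
  rw [this]
  exact biUnion_mem hC _ _ fun i _ => h2 i

theorem SF.prod {β γ : Type*} {f : X → β} {g : X → γ} (hC : IsSetField 𝒞) (hf : SF 𝒞 f)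
    (hg : SF 𝒞 g) : SF 𝒞 (fun x => (f x, g x)) := by
  apply SF.of_single hC
  · apply (hf.1.prod hg.1).subset
    rintro _ ⟨x, rfl⟩
    simp
  · rintro ⟨a, b⟩
    have : (fun x => (f x, g x)) ⁻¹' {(a, b)} = f ⁻¹' {a} ∩ g ⁻¹' {b} := by
      ext x; simp
    rw [this]
    exact inter_mem hC (hf.2 _) (hg.2 _)

theorem SF.comp₂ {β γ ζ : Type*} {f : X → β} {g : X → γ} (hC : IsSetField 𝒞) (hf : SF 𝒞 f)
    (hg : SF 𝒞 g) (ψ : β → γ → ζ) : SF 𝒞 (fun x => ψ (f x) (g x)) :=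
  (hf.prod hC hg).comp (fun z => ψ z.1 z.2)

theorem SF.const {β : Type*} (hC : IsSetField 𝒞) (c : β) : SF 𝒞 (fun _ : X => c) := by
  classical
  refine ⟨(Set.finite_singleton c).subset (by rintro _ ⟨x, rfl⟩; rfl), fun S => ?_⟩
  rw [Set.preimage_const]
  split_ifs
  · exact univ_mem hC
  · exact hC.empty_mem

theorem SF.ind (hC : IsSetField 𝒞) {E : Set X} (hE : E ∈ 𝒞) (c : ℝ) :
    SF 𝒞 (E.indicator (fun _ => c)) := by
  classical
  refine ⟨(Set.toFinite {c, 0}).subset ?_, fun S => ?_⟩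
  · rintro _ ⟨x, rfl⟩
    by_cases hx : x ∈ E <;> simp [hx]
  · by_cases h1 : c ∈ S <;> by_cases h0 : (0:ℝ) ∈ S
    · convert univ_mem hC using 1
      ext x; by_cases hx : x ∈ E <;> simp [hx, h1, h0]
    · convert hE using 1
      ext x; by_cases hx : x ∈ E <;> simp [hx, h1, h0]
    · convert hC.compl_mem _ hE using 1
      ext x; by_cases hx : x ∈ E <;> simp [hx, h1, h0]
    · convert hC.empty_mem using 1
      ext x; by_cases hx : x ∈ E <;> simp [hx, h1, h0]

theorem SF.sum (hC : IsSetField 𝒞) {ι : Type*} (s : Finset ι) (f : ι → X → ℝ)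
    (hf : ∀ i ∈ s, SF 𝒞 (f i)) : SF 𝒞 (fun x => ∑ i ∈ s, f i x) := by
  classical
  induction s using Finset.induction_on with
  | empty => simpa using SF.const hC (0:ℝ)
  | insert a s ha ih =>
    simp only [Finset.sum_insert ha]
    exact (hf a (by simp)).comp₂ hC (ih fun i hi => hf i (by simp [hi])) (· + ·)

theorem simple_iff (hC : IsSetField 𝒞) {f : X → ℝ} : IsSimpleFn 𝒞 f ↔ SF 𝒞 f := by
  classical
  constructor
  · rintro ⟨n, c, A, hA, -, -, hf⟩
    have : f = fun x => ∑ k ∈ Finset.univ, (A k).indicator (fun _ => c k) x := funext hf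
    rw [this]
    exact SF.sum hC _ _ fun k _ => SF.ind hC (hA k) _
  · intro h
    haveI := h.1.fintype
    let e := (Fintype.equivFin (Set.range f)).symm
    refine ⟨Fintype.card (Set.range f), fun k => (e k : ℝ), fun k => f ⁻¹' {(e k : ℝ)},
      fun k => h.2 _, ?_, ?_, ?_⟩
    · intro i j hij
      rw [Set.disjoint_left]
      intro x hx hy
      simp only [Set.mem_preimage, Set.mem_singleton_iff] at hx hy
      exact hij (e.injective (Subtype.ext (hx.symm.trans hy)))
    · ext x
      simp only [Set.mem_iUnion, Set.mem_univ, iff_true]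
      exact ⟨e.symm ⟨f x, x, rfl⟩, by simp⟩
    · intro x
      rw [Finset.sum_eq_single (e.symm ⟨f x, x, rfl⟩)]
      · simp
      · intro k _ hk
        apply Set.indicator_of_notMem
        intro hx
        simp only [Set.mem_preimage, Set.mem_singleton_iff] at hx
        apply hk
        rw [Equiv.eq_symm_apply]
        exact Subtype.ext hx.symm
      · simp

theorem sInt_comp (h : IsCharge 𝒞 μ) {β : Type*} {f : X → β} (hf : SF 𝒞 f) (ψ : β → ℝ) :
    sIntegral μ (fun x => ψ (f x)) = ∑ r ∈ hf.1.toFinset, ψ r * μ (f ⁻¹' {r}) := by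
  classical
  have hpre : ∀ y, μ ((fun x => ψ (f x)) ⁻¹' {y}) =
      ∑ r ∈ hf.1.toFinset.filter (fun r => ψ r = y), μ (f ⁻¹' {r}) := by
    intro y
    rw [← mu_biUnion h _ (fun r => f ⁻¹' {r}) (fun _ _ => hf.2 _)]
    · congr 1
      ext x; simp
    · intro i j hij
      rw [Set.disjoint_left]
      intro x hx hy
      exact hij (hx.symm.trans hy)
  unfold sIntegral
  rw [finsum_eq_sum_of_support_subset (s := hf.1.toFinset.image ψ)]
  · rw [← Finset.sum_fiberwise_of_maps_to (s := hf.1.toFinset) (t := hf.1.toFinset.image ψ) (g := ψ)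
      (fun i hi => Finset.mem_image_of_mem _ hi)]
    refine Finset.sum_congr rfl fun y _ => ?_
    rw [hpre, Finset.mul_sum]
    refine Finset.sum_congr rfl fun r hr => ?_
    rw [(Finset.mem_filter.mp hr).2]
  · intro y hy
    by_contra hc
    apply hy
    have : (fun x => ψ (f x)) ⁻¹' {y} = ∅ := by
      ext x
      simp only [Set.mem_preimage, Set.mem_singleton_iff, Set.mem_empty_iff_false, iff_false]
      rintro rfl
      apply hc
      simp
    simp only [this, h.empty, mul_zero]

theorem sInt_add (h : IsCharge 𝒞 μ) {f g : X → ℝ} (hf : SF 𝒞 f) (hg : SF 𝒞 g) :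
    sIntegral μ (fun x => f x + g x) = sIntegral μ f + sIntegral μ g := by
  have hp := hf.prod h.isSetField hg
  have e1 := sInt_comp h hp (fun z => z.1 + z.2)
  have e2 := sInt_comp h hp (fun z => z.1)
  have e3 := sInt_comp h hp (fun z => z.2)
  simp only at e1 e2 e3
  rw [e1, e2, e3, ← Finset.sum_add_distrib]
  exact Finset.sum_congr rfl fun _ _ => by ring

theorem sInt_mul (h : IsCharge 𝒞 μ) {f : X → ℝ} (hf : SF 𝒞 f) (c : ℝ) :
    sIntegral μ (fun x => c * f x) = c * sIntegral μ f := by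
  have e1 := sInt_comp h hf (fun z => c * z)
  have e2 := sInt_comp h hf (fun z => z)
  rw [e1, e2, Finset.mul_sum]
  exact Finset.sum_congr rfl fun _ _ => by ring

theorem sInt_mono (h : IsCharge 𝒞 μ) {f g : X → ℝ} (hf : SF 𝒞 f) (hg : SF 𝒞 g)
    (hfg : ∀ x, f x ≤ g x) : sIntegral μ f ≤ sIntegral μ g := by
  have hp := hf.prod h.isSetField hg
  have e2 := sInt_comp h hp (fun z => z.1)
  have e3 := sInt_comp h hp (fun z => z.2)
  simp only at e2 e3
  rw [e2, e3]
  refine Finset.sum_le_sum fun r hr => ?_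
  simp only [Set.Finite.mem_toFinset, Set.mem_range] at hr
  obtain ⟨x, rfl⟩ := hr
  exact mul_le_mul_of_nonneg_right (hfg x) (h.nonneg _ (hp.2 _))

theorem sInt_ind (h : IsCharge 𝒞 μ) {E : Set X} (hE : E ∈ 𝒞) :
    sIntegral μ (E.indicator (fun _ => (1:ℝ))) = μ E := by
  classical
  unfold sIntegral
  rw [finsum_eq_single _ (1:ℝ)]
  · rw [one_mul]; congr 1
    ext x; by_cases hx : x ∈ E <;> simp [hx]
  · intro y hy
    by_cases h0 : y = 0
    · simp [h0]
    · have : (E.indicator (fun _ => (1:ℝ))) ⁻¹' {y} = ∅ := by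
        ext x; by_cases hx : x ∈ E <;> simp [hx, Ne.symm hy, Ne.symm h0]
      rw [this, h.empty, mul_zero]

theorem sInt_const (h : IsCharge 𝒞 μ) (c : ℝ) :
    sIntegral μ (fun _ : X => c) = c * μ Set.univ := by
  have := sInt_mul h (SF.ind h.isSetField (univ_mem h.isSetField) 1) c
  rw [sInt_ind h (univ_mem h.isSetField)] at this
  simpa using this

theorem sInt_congr (h : IsCharge 𝒞 μ) {u v : X → ℝ} (hu : SF 𝒞 u) (hv : SF 𝒞 v) {M : Set X}
    (hM : M ∈ 𝒞) (hM0 : μ M = 0) (huv : ∀ x, x ∉ M → u x = v x) :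
    sIntegral μ u = sIntegral μ v := by
  unfold sIntegral
  refine finsum_congr fun y => ?_
  congr 1
  apply le_antisymm
  · have := mu_mono h (hu.2 {y}) (h.isSetField.union_mem _ (hv.2 {y}) _ hM) (by
      intro x hx
      by_cases hxM : x ∈ M
      · exact Or.inr hxM
      · left; simpa [← huv x hxM] using hx)
    linarith [mu_union_le h (hv.2 {y}) hM]
  · have := mu_mono h (hv.2 {y}) (h.isSetField.union_mem _ (hu.2 {y}) _ hM) (by
      intro x hx
      by_cases hxM : x ∈ M
      · exact Or.inr hxM
      · left; simpa [huv x hxM] using hx)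
    linarith [mu_union_le h (hu.2 {y}) hM]

/-- Uniform integrability of a determining sequence. -/
theorem unif_int (h : IsCharge 𝒞 μ) {fn : ℕ → X → ℝ} (hs : ∀ n, SF 𝒞 (fn n))
    (hc : Tendsto (fun mn : ℕ × ℕ => sIntegral μ (fun x => |fn mn.1 x - fn mn.2 x|)) atTop (𝓝 0))
    {η : ℝ} (hη : 0 < η) : ∃ δ > (0:ℝ), ∃ K : ℕ, ∀ E ∈ 𝒞, μ E < δ → ∀ n ≥ K,
      sIntegral μ (fun x => E.indicator (fun _ => (1:ℝ)) x * |fn n x|) < η := by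
  have hC := h.isSetField
  obtain ⟨⟨a, b⟩, hab⟩ := Filter.eventually_atTop.mp (hc.eventually (gt_mem_nhds (half_pos hη)))
  set K := max a b
  obtain ⟨M, hM⟩ := ((hs K).comp (fun z => |z|)).1.bddAbove
  have hM' : ∀ x, |fn K x| ≤ M := fun x => hM ⟨x, rfl⟩
  refine ⟨η / (2 * (|M| + 1)), by positivity, K, fun E hE hμE n hn => ?_⟩
  have h1 : sIntegral μ (fun x => |fn n x - fn K x|) < η / 2 :=
    hab (n, K) ⟨(le_max_left a b).trans hn, le_max_right a b⟩
  have hI := SF.ind hC hE (1:ℝ)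
  have s1 : SF 𝒞 (fun x => |fn n x - fn K x|) := (hs n).comp₂ hC (hs K) (fun u v => |u - v|)
  have s2 : SF 𝒞 (fun x => |M| * E.indicator (fun _ => (1:ℝ)) x) := hI.comp (fun z => |M| * z)
  have h2 := sInt_mono h (f := fun x => E.indicator (fun _ => (1:ℝ)) x * |fn n x|)
    (g := fun x => |fn n x - fn K x| + |M| * E.indicator (fun _ => (1:ℝ)) x)
    (hI.comp₂ hC (hs n) (fun u v => u * |v|)) (s1.comp₂ hC s2 (· + ·)) (by
      intro x
      by_cases hx : x ∈ E
      · simp only [hx, Set.indicator_of_mem, one_mul, mul_one]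
        have := abs_sub_abs_le_abs_sub (fn n x) (fn K x)
        linarith [hM' x, le_abs_self M]
      · simp [hx])
  rw [sInt_add h s1 s2, sInt_mul h hI, sInt_ind h hE] at h2
  have h3 : |M| * μ E ≤ η / 2 := by
    rw [lt_div_iff₀ (by positivity)] at hμE
    nlinarith [h.nonneg E hE, abs_nonneg M]
  linarith

theorem integral_tendsto (h : IsCharge 𝒞 μ) {fn : ℕ → X → ℝ} (hs : ∀ n, SF 𝒞 (fn n))
    (hc : Tendsto (fun mn : ℕ × ℕ => sIntegral μ (fun x => |fn mn.1 x - fn mn.2 x|)) atTop (𝓝 0)) :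
    ∃ L, Tendsto (fun n => sIntegral μ (fn n)) atTop (𝓝 L) := by
  have hC := h.isSetField
  have hle : ∀ n m, sIntegral μ (fn n) ≤ sIntegral μ (fn m) +
      sIntegral μ (fun x => |fn n x - fn m x|) := by
    intro n m
    have s1 : SF 𝒞 (fun x => |fn n x - fn m x|) := (hs n).comp₂ hC (hs m) (fun u v => |u - v|)
    rw [← sInt_add h (hs m) s1]
    exact sInt_mono h (hs n) ((hs m).comp₂ hC s1 (· + ·)) fun x => by
      linarith [le_abs_self (fn n x - fn m x)]
  apply cauchySeq_tendsto_of_complete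
  rw [Metric.cauchySeq_iff]
  intro ε hε
  obtain ⟨⟨a, b⟩, hab⟩ := Filter.eventually_atTop.mp (hc.eventually (gt_mem_nhds hε))
  refine ⟨max a b, fun m hm n hn => ?_⟩
  have h1 := hab (m, n) ⟨(le_max_left a b).trans hm, (le_max_right a b).trans hn⟩
  have h2 := hab (n, m) ⟨(le_max_left a b).trans hn, (le_max_right a b).trans hm⟩
  simp only at h1 h2
  rw [Real.dist_eq, abs_lt]
  constructor <;> linarith [hle m n, hle n m]

theorem abs_sInt_le (h : IsCharge 𝒞 μ) {f : X → ℝ} (hf : SF 𝒞 f) :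
    |sIntegral μ f| ≤ sIntegral μ (fun x => |f x|) := by
  rw [abs_le]
  constructor
  · have := sInt_mono h (hf.comp fun z => (-1) * |z|) hf
      (fun x => by linarith [neg_abs_le (f x)])
    rw [sInt_mul h (hf.comp fun z => |z|)] at this
    linarith
  · exact sInt_mono h hf (hf.comp fun z => |z|) fun x => le_abs_self _

theorem genField_isField (𝒮 : Set (Set X)) : IsSetField (genSetField 𝒮) :=
  ⟨fun _ h => h.1.empty_mem, fun A hA 𝒟 h => h.1.compl_mem A (hA 𝒟 h),
    fun A hA B hB 𝒟 h => h.1.union_mem A (hA 𝒟 h) B (hB 𝒟 h)⟩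

theorem subset_gen (𝒮 : Set (Set X)) : 𝒮 ⊆ genSetField 𝒮 := fun _ hA _ h => h.2 hA

theorem gen_subset {𝒮 𝒟 : Set (Set X)} (h : IsSetField 𝒟) (hs : 𝒮 ⊆ 𝒟) : genSetField 𝒮 ⊆ 𝒟 :=
  fun _ hA => hA 𝒟 ⟨h, hs⟩

theorem simple_memL0 (h : IsCharge 𝒞 μ) {f : X → ℝ} (hf : SF 𝒞 f) : MemL0 𝒞 μ f := by
  refine ⟨fun _ => f, fun _ => (simple_iff h.isSetField).2 hf, (hazy_iff h).2 ?_⟩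
  intro ε hε δ hδ
  refine Filter.Eventually.of_forall fun n => ⟨∅, h.isSetField.empty_mem, by rwa [h.empty], ?_⟩
  intro x _
  simpa using hε.le

theorem simple_memL1 (h : IsCharge 𝒞 μ) {f : X → ℝ} (hf : SF 𝒞 f) : MemL1 𝒞 μ f := by
  refine ⟨fun _ => f, fun _ => (simple_iff h.isSetField).2 hf, (hazy_iff h).2 ?_, ?_⟩
  · intro ε hε δ hδ
    refine Filter.Eventually.of_forall fun n => ⟨∅, h.isSetField.empty_mem, by rwa [h.empty], ?_⟩
    intro x _
    simpa using hε.le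
  · have : (fun mn : ℕ × ℕ => sIntegral μ (fun x => |f x - f x|)) = fun _ => 0 := by
      funext mn
      simp only [sub_self, abs_zero]
      rw [sInt_const h]; simp
    simp only [this]
    exact tendsto_const_nhds

theorem simple_memLp (h : IsCharge 𝒞 μ) {f : X → ℝ} (hf : SF 𝒞 f) (p : ℝ) :
    MemLp' 𝒞 μ p f := by
  unfold MemLp'
  split_ifs
  · exact simple_memL0 h hf
  · exact ⟨simple_memL0 h hf, simple_memL1 h (hf.comp fun z => |z| ^ p)⟩

theorem MemLp'.memL0 {p : ℝ} {f : X → ℝ} (h : MemLp' 𝒞 μ p f) : MemL0 𝒞 μ f := by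
  unfold MemLp' at h
  split_ifs at h
  · exact h
  · exact h.1

theorem hazy_mono {𝒟 : Set (Set X)} (hC : IsCharge 𝒞 μ) (hD : IsCharge 𝒟 μ) (hs : 𝒞 ⊆ 𝒟)
    {fn : ℕ → X → ℝ} {f : X → ℝ} (h : HazyConv 𝒞 μ fn f) : HazyConv 𝒟 μ fn f := by
  rw [hazy_iff hD]
  rw [hazy_iff hC] at h
  intro ε hε δ hδ
  filter_upwards [h ε hε δ hδ] with n ⟨E, h1, h2⟩
  exact ⟨E, hs h1, h2⟩

theorem simple_mono {𝒟 : Set (Set X)} (hs : 𝒞 ⊆ 𝒟) {f : X → ℝ} (h : IsSimpleFn 𝒞 f) :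
    IsSimpleFn 𝒟 f := by
  obtain ⟨n, c, A, hA, h⟩ := h
  exact ⟨n, c, A, fun k => hs (hA k), h⟩

theorem memLp_mono {𝒟 : Set (Set X)} (hC : IsCharge 𝒞 μ) (hD : IsCharge 𝒟 μ) (hs : 𝒞 ⊆ 𝒟)
    {p : ℝ} {f : X → ℝ} (h : MemLp' 𝒞 μ p f) : MemLp' 𝒟 μ p f := by
  have h0 : ∀ f, MemL0 𝒞 μ f → MemL0 𝒟 μ f := by
    rintro f ⟨fn, h1, h2⟩
    exact ⟨fn, fun n => simple_mono hs (h1 n), hazy_mono hC hD hs h2⟩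
  have h1 : ∀ f, MemL1 𝒞 μ f → MemL1 𝒟 μ f := by
    rintro f ⟨fn, h1, h2, h3⟩
    exact ⟨fn, fun n => simple_mono hs (h1 n), hazy_mono hC hD hs h2, h3⟩
  unfold MemLp' at *
  split_ifs at *
  · exact h0 _ h
  · exact ⟨h0 _ h.1, h1 _ h.2⟩

theorem null_iff {𝒜 : Set (Set X)} (hμ : IsCharge 𝒜 μ) (hpj : pjField 𝒜 μ = 𝒜) {N : Set X} :
    N ∈ nullSets 𝒜 μ ↔ N ∈ 𝒜 ∧ μ N = 0 := by
  constructor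
  · intro hN
    have hN' : ∀ ε > (0:ℝ), ∃ E ∈ 𝒜, N ⊆ E ∧ μ E < ε := by
      intro ε hε
      rw [← outer_lt_iff hμ]
      have : outerCharge 𝒜 μ N = 0 := hN
      rwa [this]
    have hA : N ∈ 𝒜 := by
      rw [← hpj]
      intro ε hε
      obtain ⟨E, h1, h2, h3⟩ := hN' ε hε
      exact ⟨∅, hμ.isSetField.empty_mem, E, h1, Set.empty_subset _, h2, by simpa using h3⟩
    refine ⟨hA, le_antisymm (le_of_forall_pos_le_add fun ε hε => ?_) (hμ.nonneg _ hA)⟩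
    obtain ⟨E, h1, h2, h3⟩ := hN' ε hε
    linarith [mu_mono hμ hA h1 h2]
  · rintro ⟨h1, h2⟩
    refine le_antisymm (le_of_forall_pos_le_add fun ε hε => ?_) (outer_nonneg hμ _)
    exact ((outer_lt_iff hμ).2 ⟨N, h1, subset_rfl, by linarith⟩).le

theorem null_union {𝒜 : Set (Set X)} (hμ : IsCharge 𝒜 μ) {M N : Set X}
    (hM : M ∈ 𝒜 ∧ μ M = 0) (hN : N ∈ 𝒜 ∧ μ N = 0) : M ∪ N ∈ 𝒜 ∧ μ (M ∪ N) = 0 := by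
  have h1 := hμ.isSetField.union_mem _ hM.1 _ hN.1
  refine ⟨h1, le_antisymm ?_ (hμ.nonneg _ h1)⟩
  linarith [mu_union_le hμ hM.1 hN.1, hM.2, hN.2]

theorem null_iUnion {𝒜 : Set (Set X)} (hμ : IsCharge 𝒜 μ) {ι : Type*} (s : Finset ι)
    (M : ι → Set X) (hM : ∀ k, M k ∈ 𝒜 ∧ μ (M k) = 0) :
    (⋃ k ∈ s, M k) ∈ 𝒜 ∧ μ (⋃ k ∈ s, M k) = 0 := by
  classical
  induction s using Finset.induction_on with
  | empty => simpa using ⟨hμ.isSetField.empty_mem, hμ.empty⟩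
  | insert a s ha ih =>
    rw [Finset.set_biUnion_insert]
    exact null_union hμ (hM a) ih

theorem gen_approx {𝒜 𝒜' : Set (Set X)} (hμ : IsCharge 𝒜 μ) (hpj : pjField 𝒜 μ = 𝒜)
    (h' : IsSetField 𝒜') {C : Set X} (hC : C ∈ genSetField (𝒜' ∪ nullSets 𝒜 μ)) :
    ∃ A ∈ 𝒜', ∃ M, (M ∈ 𝒜 ∧ μ M = 0) ∧ ∀ x, x ∉ M → (x ∈ A ↔ x ∈ C) := by
  have hE : (∅ : Set X) ∈ 𝒜 ∧ μ ∅ = 0 := ⟨hμ.isSetField.empty_mem, hμ.empty⟩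
  refine gen_subset (𝒟 := {C | ∃ A ∈ 𝒜', ∃ M, (M ∈ 𝒜 ∧ μ M = 0) ∧
    ∀ x, x ∉ M → (x ∈ A ↔ x ∈ C)}) ⟨?_, ?_, ?_⟩ ?_ hC
  · exact ⟨∅, h'.empty_mem, ∅, hE, fun _ _ => Iff.rfl⟩
  · rintro C ⟨A, hA, M, hM, h⟩
    exact ⟨Aᶜ, h'.compl_mem _ hA, M, hM, fun x hx => not_congr (h x hx)⟩
  · rintro C ⟨A, hA, M, hM, h⟩ D ⟨B, hB, N, hN, k⟩
    refine ⟨A ∪ B, h'.union_mem _ hA _ hB, M ∪ N, null_union hμ hM hN, fun x hx => ?_⟩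
    exact or_congr (h x fun hh => hx (Or.inl hh)) (k x fun hh => hx (Or.inr hh))
  · rintro C (hC | hC)
    · exact ⟨C, hC, ∅, hE, fun _ _ => Iff.rfl⟩
    · refine ⟨∅, h'.empty_mem, C, (null_iff hμ hpj).1 hC, fun x hx => ?_⟩
      simpa using hx

theorem simple_approx {𝒜 𝒜' : Set (Set X)} (hμ : IsCharge 𝒜 μ) (hpj : pjField 𝒜 μ = 𝒜)
    (h' : IsSetField 𝒜') {s : X → ℝ} (hs : IsSimpleFn (genSetField (𝒜' ∪ nullSets 𝒜 μ)) s) :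
    ∃ g, SF 𝒜' g ∧ ∃ M, (M ∈ 𝒜 ∧ μ M = 0) ∧ ∀ x, x ∉ M → g x = s x := by
  obtain ⟨n, c, C, hC, -, -, hs⟩ := hs
  choose A hA M hM hAM using fun k => gen_approx hμ hpj h' (hC k)
  refine ⟨fun x => ∑ k ∈ Finset.univ, (A k).indicator (fun _ => c k) x,
    SF.sum h' _ _ fun k _ => SF.ind h' (hA k) _, _, null_iUnion hμ Finset.univ M hM, ?_⟩
  intro x hx
  rw [hs]
  refine Finset.sum_congr rfl fun k _ => ?_
  have hk : x ∉ M k := fun hh => hx (by simpa using ⟨k, hh⟩)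
  have := hAM k x hk
  by_cases h : x ∈ A k
  · rw [Set.indicator_of_mem h, Set.indicator_of_mem (this.1 h)]
  · rw [Set.indicator_of_notMem h, Set.indicator_of_notMem fun hh => h (this.2 hh)]

/-- The pointwise truncation estimate. -/
theorem clamp_est {p : ℝ} (hp : 1 ≤ p) {a f φ δ : ℝ} (hδ : 0 < δ) (h1 : |a - f| ≤ δ)
    (h2 : |φ - |f| ^ p| ≤ δ ^ p) :
    |max (-(|φ| ^ (1 / p))) (min a (|φ| ^ (1 / p))) - f| ≤ δ := by
  have hp0 : 0 < p := by linarith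
  set r := |φ| ^ (1 / p) with hr
  have hr0 : 0 ≤ r := by positivity
  have hrp : r ^ p = |φ| := by
    rw [hr, ← Real.rpow_mul (abs_nonneg _), one_div_mul_cancel hp0.ne', Real.rpow_one]
  have hfp : 0 ≤ |f| ^ p := by positivity
  have hφ1 : |φ| ≤ |f| ^ p + δ ^ p := by
    have := abs_sub_abs_le_abs_sub φ (|f| ^ p)
    rw [abs_of_nonneg hfp] at this
    linarith
  have hφ2 : |f| ^ p ≤ |φ| + δ ^ p := by
    have := (abs_le.1 h2).1
    linarith [le_abs_self φ]
  have hr1 : r ≤ |f| + δ := by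
    rw [← Real.rpow_le_rpow_iff hr0 (by positivity) hp0, hrp]
    exact hφ1.trans (Real.add_rpow_le_rpow_add (abs_nonneg _) hδ.le hp)
  have hr2 : |f| ≤ r + δ := by
    rw [← Real.rpow_le_rpow_iff (abs_nonneg _) (by positivity) hp0]
    rw [← hrp] at hφ2
    exact hφ2.trans (Real.add_rpow_le_rpow_add hr0 hδ.le hp)
  have hf1 := neg_abs_le f
  have hf2 := le_abs_self f
  rw [abs_le] at h1 ⊢
  rcases le_total a r with h | h
  · rw [min_eq_left h]
    rcases le_total (-r) a with h' | h'
    · rw [max_eq_right h']; exact h1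
    · rw [max_eq_left h']
      constructor
      · rcases abs_cases f with ⟨e, _⟩ | ⟨e, _⟩ <;> linarith [h1.1]
      · linarith
  · rw [min_eq_right h, max_eq_right (by linarith)]
    constructor
    · linarith
    · rcases abs_cases f with ⟨e, _⟩ | ⟨e, _⟩ <;> linarith [h1.2]

theorem clamp_pow {p : ℝ} (hp : 1 ≤ p) (a φ : ℝ) :
    |max (-(|φ| ^ (1 / p))) (min a (|φ| ^ (1 / p)))| ^ p ≤ |φ| := by
  have hp0 : 0 < p := by linarith
  set r := |φ| ^ (1 / p) with hr
  have hr0 : 0 ≤ r := by positivity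
  have hrp : r ^ p = |φ| := by
    rw [hr, ← Real.rpow_mul (abs_nonneg _), one_div_mul_cancel hp0.ne', Real.rpow_one]
  rw [← hrp]
  apply Real.rpow_le_rpow (abs_nonneg _) _ hp0.le
  rw [abs_le]
  exact ⟨le_max_left _ _, max_le (by linarith) (min_le_right _ _)⟩

theorem sub_pow_le {p : ℝ} (hp : 1 ≤ p) (a b : ℝ) :
    |a - b| ^ p ≤ 2 ^ p * (|a| ^ p + |b| ^ p) := by
  have hp0 : 0 < p := by linarith
  have h1 : |a - b| ≤ 2 * max |a| |b| := by
    linarith [abs_sub a b, le_max_left |a| |b|, le_max_right |a| |b|]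
  have h2 : |a - b| ^ p ≤ (2 * max |a| |b|) ^ p :=
    Real.rpow_le_rpow (abs_nonneg _) h1 hp0.le
  rw [Real.mul_rpow (by norm_num) (by positivity)] at h2
  refine h2.trans (mul_le_mul_of_nonneg_left ?_ (by positivity))
  have ha : 0 ≤ |a| ^ p := by positivity
  have hb : 0 ≤ |b| ^ p := by positivity
  rcases max_choice |a| |b| with h | h <;> rw [h] <;> linarith

/-- Density of `L_p`-simple functions, in the form needed. -/
theorem dense_Lp (h : IsCharge 𝒞 μ) {p : ℝ} (hp : 1 ≤ p) {f : X → ℝ} (hf : MemLpC 𝒞 μ p f)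
    {ε : ℝ} (hε : 0 < ε) : ∃ s, SF 𝒞 s ∧ ∀ g M, M ∈ 𝒞 → μ M = 0 → (∀ x, x ∉ M → g x = s x) →
      LpDist 𝒞 μ p f g < ε := by
  have hC := h.isSetField
  have hp0 : 0 < p := by linarith
  obtain ⟨⟨fn, hfs, hfh⟩, φ, hφs, hφh, hφc⟩ := hf
  rw [hazy_iff h] at hfh hφh
  replace hfs := fun n => (simple_iff hC).1 (hfs n)
  replace hφs := fun n => (simple_iff hC).1 (hφs n)
  set η : ℝ := (ε / 2) ^ p with hη
  have hη0 : 0 < η := by positivity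
  set c : ℝ := 2 ^ p with hc
  have hc0 : 0 < c := by positivity
  set m := μ Set.univ with hm
  have hm0 : 0 ≤ m := h.nonneg _ (univ_mem hC)
  set η₁ : ℝ := η / (2 * (1 + 2 * c)) with hη₁
  have hη₁0 : 0 < η₁ := by positivity
  set δ : ℝ := min 1 (η / (2 * (m + 1) * (2 + c))) with hδ
  have hδ0 : 0 < δ := lt_min one_pos (by positivity)
  have hδ1 : δ ≤ 1 := min_le_left _ _
  have hδp : δ ^ p ≤ δ := by
    simpa using Real.rpow_le_rpow_of_exponent_ge hδ0 hδ1 hp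
  have hδp0 : 0 < δ ^ p := by positivity
  obtain ⟨δ₀, hδ₀, K₀, hK₀⟩ := unif_int h hφs hφc hη₁0
  obtain ⟨N, ⟨⟨E₁, hE₁, hμE₁, hE₁'⟩, E₂, hE₂, hμE₂, hE₂'⟩, hNK⟩ :=
    ((hfh δ hδ0 (δ₀ / 2) (by positivity)).and (hφh (δ ^ p) hδp0 (δ₀ / 2) (by positivity))
      |>.and (eventually_ge_atTop K₀)).exists
  set E := E₁ ∪ E₂ with hEdef
  have hE : E ∈ 𝒞 := hC.union_mem _ hE₁ _ hE₂
  have hμE : μ E < δ₀ := by linarith [mu_union_le h hE₁ hE₂]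
  set s : X → ℝ := fun x => max (-(|φ N x| ^ (1 / p))) (min (fn N x) (|φ N x| ^ (1 / p))) with hs
  have hsE : ∀ x, x ∉ E → |s x - f x| ≤ δ := fun x hx =>
    clamp_est hp hδ0 (hE₁' x fun hh => hx (Or.inl hh)) (hE₂' x fun hh => hx (Or.inr hh))
  have hsp : ∀ x, |s x| ^ p ≤ |φ N x| := fun x => clamp_pow hp _ _
  refine ⟨s, (hφs N).comp₂ hC (hfs N)
    (fun u v => max (-(|u| ^ (1 / p))) (min v (|u| ^ (1 / p)))), ?_⟩
  intro g M hM hM0 hgs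
  unfold LpDist
  rw [if_neg hp0.ne']
  unfold chargeIntegral
  split_ifs with hex
  swap
  · rw [Real.zero_rpow (by positivity)]; exact hε
  obtain ⟨hs1, hs2, hs3⟩ := hex.choose_spec
  set w := hex.choose with hw
  clear_value w
  rw [hazy_iff h] at hs2
  replace hs1 := fun n => (simple_iff hC).1 (hs1 n)
  obtain ⟨L, hL⟩ := integral_tendsto h hs1 hs3
  rw [hL.limUnder_eq]
  obtain ⟨δ₁, hδ₁, K₁, hK₁⟩ := unif_int h hs1 hs3 hη₁0
  have hbound : ∀ᶠ n in atTop, |sIntegral μ (w n)| ≤ η := by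
    filter_upwards [hs2 δ hδ0 (δ₁ / 2) (by positivity), hφh δ hδ0 (δ₁ / 2) (by positivity),
      eventually_ge_atTop K₀, eventually_ge_atTop K₁] with n ⟨F₁, hF₁, hμF₁, hF₁'⟩
      ⟨F₂, hF₂, hμF₂, hF₂'⟩ hn0 hn1
    refine (abs_sInt_le h (hs1 n)).trans ?_
    set F := F₁ ∪ F₂ ∪ M with hFdef
    have hF12 := hC.union_mem _ hF₁ _ hF₂
    have hF : F ∈ 𝒞 := hC.union_mem _ hF12 _ hM
    have hμF : μ F < δ₁ := by linarith [mu_union_le h hF₁ hF₂, mu_union_le h hF12 hM]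
    have hIE := SF.ind hC hE (1:ℝ)
    have hIF := SF.ind hC hF (1:ℝ)
    have t1 : SF 𝒞 (fun x => F.indicator (fun _ => (1:ℝ)) x * |w n x|) :=
      hIF.comp₂ hC (hs1 n) (fun u v => u * |v|)
    have t2' : SF 𝒞 (fun x => E.indicator (fun _ => (1:ℝ)) x * |φ n x|) :=
      hIE.comp₂ hC (hφs n) (fun u v => u * |v|)
    have t3' : SF 𝒞 (fun x => E.indicator (fun _ => (1:ℝ)) x * |φ N x|) :=
      hIE.comp₂ hC (hφs N) (fun u v => u * |v|)
    have t2 : SF 𝒞 (fun x => c * (E.indicator (fun _ => (1:ℝ)) x * |φ n x|)) :=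
      t2'.comp (fun u => c * u)
    have t3 : SF 𝒞 (fun x => c * (E.indicator (fun _ => (1:ℝ)) x * |φ N x|)) :=
      t3'.comp (fun u => c * u)
    have t4 : SF 𝒞 (fun _ : X => 2 * δ + c * δ) := SF.const hC _
    have t12 : SF 𝒞 (fun x => F.indicator (fun _ => (1:ℝ)) x * |w n x| +
      c * (E.indicator (fun _ => (1:ℝ)) x * |φ n x|)) := t1.comp₂ hC t2 (· + ·)
    have t123 : SF 𝒞 (fun x => F.indicator (fun _ => (1:ℝ)) x * |w n x| +
      c * (E.indicator (fun _ => (1:ℝ)) x * |φ n x|) +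
      c * (E.indicator (fun _ => (1:ℝ)) x * |φ N x|)) := t12.comp₂ hC t3 (· + ·)
    have t1234 : SF 𝒞 (fun x => F.indicator (fun _ => (1:ℝ)) x * |w n x| +
      c * (E.indicator (fun _ => (1:ℝ)) x * |φ n x|) +
      c * (E.indicator (fun _ => (1:ℝ)) x * |φ N x|) + (2 * δ + c * δ)) :=
      t123.comp₂ hC t4 (· + ·)
    have hle := sInt_mono h ((hs1 n).comp fun z => |z|) t1234 (by
      intro x
      have hcd : 0 < c * δ := by positivity
      have n1 : 0 ≤ c * |φ n x| := by positivity
      have n2 : 0 ≤ c * |φ N x| := by positivity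
      by_cases hxF : x ∈ F
      · rw [Set.indicator_of_mem hxF]
        by_cases hxE : x ∈ E
        · rw [Set.indicator_of_mem hxE]; linarith
        · rw [Set.indicator_of_notMem hxE]; linarith
      · rw [Set.indicator_of_notMem hxF]
        have a1 : |w n x - |f x - g x| ^ p| ≤ δ := hF₁' x fun hh => hxF (Or.inl (Or.inl hh))
        have a2 : |φ n x - |f x| ^ p| ≤ δ := hF₂' x fun hh => hxF (Or.inl (Or.inr hh))
        have a3 : g x = s x := hgs x fun hh => hxF (Or.inr hh)
        rw [a3] at a1
        have q0 : 0 ≤ |f x - s x| ^ p := by positivity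
        have a4 : |w n x| ≤ |f x - s x| ^ p + δ := by
          have := abs_sub_abs_le_abs_sub (w n x) (|f x - s x| ^ p)
          rw [abs_of_nonneg q0] at this
          linarith
        by_cases hxE : x ∈ E
        · rw [Set.indicator_of_mem hxE]
          have a5 := sub_pow_le hp (f x) (s x)
          have a6 : |f x| ^ p ≤ |φ n x| + δ := by
            linarith [(abs_le.1 a2).1, le_abs_self (φ n x)]
          have a7 := mul_le_mul_of_nonneg_left (add_le_add a6 (hsp x)) hc0.le
          rw [← hc] at a5
          linarith
        · rw [Set.indicator_of_notMem hxE]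
          have a5 := hsE x hxE
          rw [abs_sub_comm] at a5
          have a6 := Real.rpow_le_rpow (abs_nonneg _) a5 hp0.le
          linarith)
    rw [sInt_add h t123 t4, sInt_add h t12 t3, sInt_add h t1 t2, sInt_mul h t2', sInt_mul h t3',
      sInt_const h] at hle
    have b1 := hK₁ F hF hμF n hn1
    have b2 := mul_le_mul_of_nonneg_left (hK₀ E hE hμE n hn0).le hc0.le
    have b3 := mul_le_mul_of_nonneg_left (hK₀ E hE hμE N hNK).le hc0.le
    have b4 : η₁ * (1 + 2 * c) = η / 2 := by rw [hη₁]; field_simp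
    have b5 : (2 * δ + c * δ) * m ≤ η / 2 := by
      have : δ ≤ η / (2 * (m + 1) * (2 + c)) := min_le_right _ _
      rw [le_div_iff₀ (by positivity)] at this
      have : 0 < δ * (2 + c) := by positivity
      nlinarith
    rw [← hm] at hle
    linarith
  have hLη : |L| ≤ η := le_of_tendsto hL.abs hbound
  calc L ^ (1 / p) ≤ |L ^ (1 / p)| := le_abs_self _
    _ ≤ |L| ^ (1 / p) := Real.abs_rpow_le_abs_rpow _ _
    _ ≤ η ^ (1 / p) := Real.rpow_le_rpow (abs_nonneg _) hLη (by positivity)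
    _ = ε / 2 := by
        rw [hη, ← Real.rpow_mul (by positivity), mul_one_div_cancel hp0.ne', Real.rpow_one]
    _ < ε := by linarith

theorem dense_L0 (h : IsCharge 𝒞 μ) {f : X → ℝ} (hf : MemL0 𝒞 μ f)
    {ε : ℝ} (hε : 0 < ε) : ∃ s, SF 𝒞 s ∧ ∀ g M, M ∈ 𝒞 → μ M = 0 → (∀ x, x ∉ M → g x = s x) →
      hazyDist 𝒞 μ f g < ε := by
  have hC := h.isSetField
  obtain ⟨fn, hfs, hfh⟩ := hf
  rw [hazy_iff h] at hfh
  obtain ⟨n, E, hE, hμE, hE'⟩ := (hfh (ε / 2) (by positivity) (ε / 2) (by positivity)).exists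
  refine ⟨fn n, (simple_iff hC).1 (hfs n), fun g M hM hM0 hg => ?_⟩
  refine lt_of_le_of_lt (csInf_le ⟨0, fun _ hx => hx.1.le⟩ ⟨half_pos hε, ?_⟩) (half_lt_self hε)
  rw [outer_lt_iff h]
  refine ⟨E ∪ M, hC.union_mem _ hE _ hM, fun x hx => ?_, by linarith [mu_union_le h hE hM]⟩
  by_contra hc
  have h1 := hE' x fun hh => hc (Or.inl hh)
  have h2 := hg x fun hh => hc (Or.inr hh)
  rw [← h2, abs_sub_comm] at h1
  exact absurd h1 (not_le.mpr hx)

end ChargeAux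

open ChargeAux in
/-- Let `(X,𝒜,μ)` be Peano-Jordan complete with null sets `𝒩`, `𝒜′`
a sub-field, and `p ∈ {0} ∪ [1,∞)`. Then `L_p(X,𝒜′,μ)` is a dense subspace of
`L_p(X, α(𝒜′ ∪ 𝒩), μ)` (w.r.t. `d` for `p = 0` and `‖·‖_p` for `p ≥ 1`); moreover
`L_p(X,𝒜′,μ) = L_p(X, α(𝒜′ ∪ 𝒩), μ)` iff `𝒩 ⊆ \overline{𝒜′}`. -/
theorem null_sets_dense_and_eq_iff {X : Type*} (𝒜 𝒜' : Set (Set X)) (μ : Set X → ℝ)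
    (hμ : IsCharge 𝒜 μ) (hpj : pjField 𝒜 μ = 𝒜)
    (h𝒜' : IsSetField 𝒜') (hsub : 𝒜' ⊆ 𝒜)
    (p : ℝ) (hp : p = 0 ∨ 1 ≤ p) :
    ((∀ g : X → ℝ, MemLp' 𝒜' μ p g → MemLp' (genSetField (𝒜' ∪ nullSets 𝒜 μ)) μ p g) ∧
     (∀ f : X → ℝ, MemLp' (genSetField (𝒜' ∪ nullSets 𝒜 μ)) μ p f →
        ∀ ε > (0 : ℝ), ∃ g : X → ℝ, MemLp' 𝒜' μ p g ∧
          LpDist (genSetField (𝒜' ∪ nullSets 𝒜 μ)) μ p f g < ε)) ∧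
    ((∀ f : X → ℝ, MemLp' 𝒜' μ p f ↔ MemLp' (genSetField (𝒜' ∪ nullSets 𝒜 μ)) μ p f) ↔
      nullSets 𝒜 μ ⊆ pjField 𝒜' μ) := by
  classical
  set 𝒞 := genSetField (𝒜' ∪ nullSets 𝒜 μ) with h𝒞
  have hnull := fun N : Set X => null_iff hμ hpj (N := N)
  have hCf : IsSetField 𝒞 := genField_isField _
  have hCA : 𝒞 ⊆ 𝒜 := gen_subset hμ.isSetField
    (Set.union_subset hsub fun N hN => ((hnull N).1 hN).1)
  have hA'C : 𝒜' ⊆ 𝒞 := Set.subset_union_left.trans (subset_gen _)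
  have hNC : ∀ N, N ∈ 𝒜 ∧ μ N = 0 → N ∈ 𝒞 := fun N hN =>
    subset_gen _ (Or.inr ((hnull N).2 hN))
  have hC : IsCharge 𝒞 μ := sub_charge hμ hCf hCA
  have hA' : IsCharge 𝒜' μ := sub_charge hμ h𝒜' hsub
  refine ⟨⟨fun g hg => memLp_mono hA' hC hA'C hg, fun f hf ε hε => ?_⟩, ⟨fun hEq N hN => ?_,
    fun hN f => ⟨memLp_mono hA' hC hA'C, fun hf => ?_⟩⟩⟩
  · have key : ∃ s, SF 𝒞 s ∧ ∀ g M, M ∈ 𝒞 → μ M = 0 → (∀ x, x ∉ M → g x = s x) →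
        LpDist 𝒞 μ p f g < ε := by
      rcases hp with rfl | hp
      · have := dense_L0 hC (MemLp'.memL0 hf) hε
        simpa only [LpDist, if_true] using this
      · have hp0 : p ≠ 0 := by linarith
        unfold MemLp' at hf
        rw [if_neg hp0] at hf
        exact dense_Lp hC hp hf hε
    obtain ⟨s, hs, hs'⟩ := key
    obtain ⟨g, hg, M, hM, hgM⟩ := simple_approx hμ hpj h𝒜' ((simple_iff hCf).2 hs)
    exact ⟨g, simple_memLp hA' hg p, hs' g M (hNC M hM) hM.2 hgM⟩
  · have h1 := (hEq (N.indicator fun _ => (1:ℝ))).2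
      (simple_memLp hC (SF.ind hCf (hNC N ((hnull N).1 hN)) 1) p)
    obtain ⟨fn, hfs, hfh⟩ := MemLp'.memL0 h1
    rw [hazy_iff hA'] at hfh
    intro ε hε
    obtain ⟨n, E, hE, hμE, hE'⟩ := (hfh (1 / 4) (by norm_num) ε hε).exists
    have hA : fn n ⁻¹' (Set.Ioi (1 / 2)) ∈ 𝒜' := ((simple_iff h𝒜').1 (hfs n)).2 _
    refine ⟨_, diff_mem h𝒜' hA hE, _, h𝒜'.union_mem _ hA _ hE, ?_, ?_, ?_⟩
    · rintro x ⟨hx, hxE⟩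
      by_contra hxN
      have := hE' x hxE
      rw [Set.indicator_of_notMem hxN, abs_le] at this
      have hx' : 1 / 2 < fn n x := hx
      linarith [this.2]
    · intro x hxN
      by_cases hxE : x ∈ E
      · exact Or.inr hxE
      · left
        have := hE' x hxE
        rw [Set.indicator_of_mem hxN, abs_le] at this
        change 1 / 2 < fn n x
        linarith [this.1]
    · refine lt_of_le_of_lt (mu_mono hA' (diff_mem h𝒜' (h𝒜'.union_mem _ hA _ hE)
        (diff_mem h𝒜' hA hE)) hE ?_) hμE
      rintro x ⟨hx | hx, hx'⟩
      · by_contra hxE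
        exact hx' ⟨hx, hxE⟩
      · exact hx
  · have hcover : ∀ M, M ∈ 𝒜 ∧ μ M = 0 → ∀ δ > (0:ℝ), ∃ D ∈ 𝒜', M ⊆ D ∧ μ D < δ := by
      intro M hM δ hδ
      obtain ⟨B, hB, D, hD, hBM, hMD, hlt⟩ := hN ((hnull M).2 hM) δ hδ
      refine ⟨D, hD, hMD, ?_⟩
      have h1 := mu_mono hμ (hsub hB) hM.1 hBM
      have h2 := mu_union_le hA' hB (diff_mem h𝒜' hD hB)
      have h3 := mu_mono hA' hD (h𝒜'.union_mem _ hB _ (diff_mem h𝒜' hD hB)) (by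
        intro x hx
        by_cases hxB : x ∈ B
        · exact Or.inl hxB
        · exact Or.inr ⟨hx, hxB⟩)
      linarith [hM.2]
    have htrans : ∀ (fn gn : ℕ → X → ℝ) (M : ℕ → Set X) (f : X → ℝ),
        (∀ n, M n ∈ 𝒜 ∧ μ (M n) = 0) → (∀ n x, x ∉ M n → gn n x = fn n x) →
        HazyConv 𝒞 μ fn f → HazyConv 𝒜' μ gn f := by
      intro fn gn M f hM hgf hh
      rw [hazy_iff hA']
      rw [hazy_iff hC] at hh
      intro ε hε δ hδ
      filter_upwards [hh ε hε (δ / 2) (by positivity)] with n ⟨E, hE, hμE, hE'⟩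
      obtain ⟨A, hA, M', hM', hAM⟩ := gen_approx hμ hpj h𝒜' hE
      have hU := null_union hμ hM' (hM n)
      obtain ⟨D, hD, hMD, hμD⟩ := hcover _ hU (δ / 2) (by positivity)
      have h1 : μ A ≤ μ (E ∪ M') := mu_mono hμ (hsub hA)
        (hμ.isSetField.union_mem _ (hCA hE) _ hM'.1) (by
          intro x hx
          by_cases hxM : x ∈ M'
          · exact Or.inr hxM
          · exact Or.inl ((hAM x hxM).1 hx))
      have h2 := mu_union_le hμ (hCA hE) hM'.1
      have h3 := mu_union_le hA' hA hD
      refine ⟨A ∪ D, h𝒜'.union_mem _ hA _ hD, by linarith [hM'.2], fun x hx => ?_⟩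
      have hxA : x ∉ A := fun hh => hx (Or.inl hh)
      have hxD : x ∉ D := fun hh => hx (Or.inr hh)
      have hxM' : x ∉ M' := fun hh => hxD (hMD (Or.inl hh))
      have hxM : x ∉ M n := fun hh => hxD (hMD (Or.inr hh))
      rw [hgf n x hxM]
      exact hE' x fun hh => hxA ((hAM x hxM').2 hh)
    have h0 : ∀ f, MemL0 𝒞 μ f → MemL0 𝒜' μ f := by
      rintro f ⟨fn, hfs, hfh⟩
      choose gn hg M hM hgM using fun n => simple_approx hμ hpj h𝒜' (hfs n)
      exact ⟨gn, fun n => (simple_iff h𝒜').2 (hg n), htrans fn gn M f hM hgM hfh⟩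
    have h1 : ∀ f, MemL1 𝒞 μ f → MemL1 𝒜' μ f := by
      rintro f ⟨fn, hfs, hfh, hfc⟩
      choose gn hg M hM hgM using fun n => simple_approx hμ hpj h𝒜' (hfs n)
      refine ⟨gn, fun n => (simple_iff h𝒜').2 (hg n), htrans fn gn M f hM hgM hfh, ?_⟩
      refine hfc.congr fun ⟨a, b⟩ => ?_
      have hU := null_union hμ (hM a) (hM b)
      have hF : ∀ n, SF 𝒞 (fn n) := fun n => (simple_iff hCf).1 (hfs n)
      have hG : ∀ n, SF 𝒞 (gn n) := fun n => ⟨(hg n).1, fun S => hA'C ((hg n).2 S)⟩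
      refine sInt_congr hC ((hF a).comp₂ hCf (hF b) fun u v => |u - v|)
        ((hG a).comp₂ hCf (hG b) fun u v => |u - v|) (hNC _ hU) hU.2 fun x hx => ?_
      simp only
      rw [hgM a x fun hh => hx (Or.inl hh), hgM b x fun hh => hx (Or.inr hh)]
    unfold MemLp' at *
    split_ifs at *
    · exact h0 _ hf
    · exact ⟨h0 _ hf.1, h1 _ hf.2⟩
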